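/- arXiv:2003.08537 — 4 statements merged into one kernel-verified Lean document; each statement's English description precedes it below -/
import Mathlib

section
/- Let W = w₁⊗⋯⊗wₙ ∈ ℝ^{d₁×⋯×dₙ} be a CP rank-one tensor with strictly positive entries, and fix Ω ⊆ [d₁]×⋯×[dₙ]. Let T ∈ ℝ^{d₁×⋯×dₙ} have CP rank r, let Z have i.i.d. entries Z_{i₁⋯iₙ} ∼ N(0,σ²), set Y_Ω = 1_Ω∘(T+Z), and let T̂ = W^{(−1/2)}∘X̂ where X̂ minimizes ‖X − W^{(−1/2)}∘Y_Ω‖_F over all tensors X of CP rank at most r. Set μ² = max_{(i₁,…,iₙ)∈Ω} 1/W_{i₁⋯iₙ}. Then with probability at least 1 − 2^{−|Ω|/2} over the choice of Z, ‖W^{(1/2)}∘(T−T̂)‖_F ≤ 2‖T‖_∞·‖W^{(1/2)} − W^{(−1/2)}∘1_Ω‖_F + 4σμ√(|Ω|·log 2). -/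
open MeasureTheory ProbabilityTheory Matrix
open scoped BigOperators ENNReal

namespace WTC

variable {n : ℕ}

/-- The index set `[d₁] × ⋯ × [dₙ]`. -/
abbrev Index (d : Fin n → ℕ) := ∀ j, Fin (d j)

/-- A real tensor of size `d₁ × ⋯ × dₙ`. -/
abbrev Tensor (d : Fin n → ℕ) := Index d → ℝ

variable {d : Fin n → ℕ}

/-- Frobenius norm of a tensor. -/
noncomputable def frobNorm (X : Tensor d) : ℝ :=
  Real.sqrt (∑ i : Index d, X i ^ 2)

/-- Sup (max-abs-entry) norm of a tensor. -/
noncomputable def infNorm (X : Tensor d) : ℝ := ⨆ i : Index d, |X i|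

/-- Hadamard (entrywise) product. -/
def hadamard (X Y : Tensor d) : Tensor d := fun i => X i * Y i

/-- Entrywise real power `X^{(α)}`. -/
noncomputable def epow (X : Tensor d) (α : ℝ) : Tensor d := fun i => X i ^ α

/-- The indicator tensor `1_Ω` of a sampling pattern. -/
def indic (Ω : Finset (Index d)) : Tensor d := fun i => if i ∈ Ω then 1 else 0

/-- The CP rank-one tensor `w₁ ⊗ ⋯ ⊗ wₙ`. -/
def outer (w : ∀ j, Fin (d j) → ℝ) : Tensor d := fun i => ∏ j, w j (i j)

/-- Index type for the columns of the mode-`k` matricization. -/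
abbrev RestIdx (d : Fin n → ℕ) (k : Fin n) := ∀ j : {j : Fin n // j ≠ k}, Fin (d j.1)

/-- Assemble a full index from a mode-`k` index and the remaining indices. -/
def embed (k : Fin n) (ik : Fin (d k)) (rest : RestIdx d k) : Index d :=
  fun j => if h : j = k then cast (congrArg (fun t => Fin (d t)) h).symm ik else rest ⟨j, h⟩

/-- Mode-`k` matricization of a tensor. -/
def matricize (k : Fin n) (X : Tensor d) : Matrix (Fin (d k)) (RestIdx d k) ℝ :=
  fun ik rest => X (embed k ik rest)

/-- Spectral norm (largest singular value) of a matrix. -/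
noncomputable def specNorm {m l : Type*} [Fintype m] [Fintype l] [DecidableEq l]
    (M : Matrix m l ℝ) : ℝ :=
  ‖LinearMap.toContinuousLinearMap (Matrix.toEuclideanLin M)‖

/-- `X` has Tucker rank at most `r`. -/
def TuckerRankLE (X : Tensor d) (r : Fin n → ℕ) : Prop :=
  ∀ k, (matricize k X).rank ≤ r k

/-- `X` has Tucker rank exactly `r`. -/
def TuckerRankEq (X : Tensor d) (r : Fin n → ℕ) : Prop :=
  ∀ k, (matricize k X).rank = r k

/-- `X` has CP rank at most `r`. -/
def CPRankLE (X : Tensor d) (r : ℕ) : Prop :=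
  ∃ v : Fin r → ∀ j, Fin (d j) → ℝ, X = fun i => ∑ s, ∏ j, v s j (i j)

/-- Mode-`k` product of a tensor with a square matrix: `(X ×ₖ A)_(k) = A · X_(k)`. -/
noncomputable def modeProd (k : Fin n) (X : Tensor d)
    (A : Matrix (Fin (d k)) (Fin (d k)) ℝ) : Tensor d :=
  fun i => ∑ s : Fin (d k), A (i k) s * X (Function.update i k s)

/-- Sequential mode products `X ×₁ A₁ ×₂ ⋯ ×ₙ Aₙ`. -/
noncomputable def modeProds (X : Tensor d)
    (A : ∀ k, Matrix (Fin (d k)) (Fin (d k)) ℝ) : Tensor d :=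
  (List.finRange n).foldl (fun Y k => modeProd k Y (A k)) X

/-- `That` is a weighted HOSVD estimate built from observations `Y` (typically `Y = Y_Ω`),
weight `W` and multilinear rank `r`. -/
def IsHOSVDEstimate (W : Tensor d) (r : Fin n → ℕ) (Y : Tensor d) (That : Tensor d) : Prop :=
  ∃ U : ∀ k, Matrix (Fin (d k)) (Fin (r k)) ℝ,
    (∀ k, (U k)ᵀ * U k = 1) ∧
    (∀ k, ∀ B : Matrix (Fin (d k)) (RestIdx d k) ℝ, B.rank ≤ r k →
      specNorm (matricize k (hadamard (epow W (-(1/2))) Y)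
          - U k * (U k)ᵀ * matricize k (hadamard (epow W (-(1/2))) Y))
        ≤ specNorm (matricize k (hadamard (epow W (-(1/2))) Y) - B)) ∧
    That = hadamard (epow W (-(1/2)))
      (modeProds (hadamard (epow W (-(1/2))) Y) (fun k => U k * (U k)ᵀ))

/-- Distribution of a tensor with i.i.d. `N(0, σ²)` entries. -/
noncomputable def gaussianTensor (d : Fin n → ℕ) (σ : ℝ) : Measure (Tensor d) :=
  Measure.pi fun _ : Index d => gaussianReal 0 (σ ^ 2).toNNReal

/-- Bernoulli measure on `Bool` with success probability `p`. -/
noncomputable def bern (p : ℝ) : Measure Bool :=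
  ENNReal.ofReal p • Measure.dirac true + ENNReal.ofReal (1 - p) • Measure.dirac false

/-- Distribution of a random sampling pattern `Ω ∼ W`: each index is included
independently with probability `W i`.  A pattern is encoded as a boolean function. -/
noncomputable def sampleMeasure (W : Tensor d) : Measure (Index d → Bool) :=
  Measure.pi fun i => bern (W i)

/-- Indicator tensor of a boolean sampling pattern. -/
def bindic (ω : Index d → Bool) : Tensor d := fun i => if ω i then 1 else 0

/-- The size `|Ω|` of a boolean sampling pattern. -/
noncomputable def patCard (ω : Index d → Bool) : ℕ :=
  (Finset.univ.filter fun i : Index d => ω i = true).card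


/-- `ℓ¹` norm of a vector. -/
noncomputable def l1 {ι : Type*} [Fintype ι] (v : ι → ℝ) : ℝ := ∑ i, |v i|

/-- `ℓ²` norm of a vector. -/
noncomputable def l2 {ι : Type*} [Fintype ι] (v : ι → ℝ) : ℝ := Real.sqrt (∑ i, v i ^ 2)

/-- `ℓ^∞` norm of a vector. -/
noncomputable def linf {ι : Type*} [Fintype ι] (v : ι → ℝ) : ℝ := ⨆ i, |v i|

/-- Frobenius norm of a matrix. -/
noncomputable def matFrob {m l : Type*} [Fintype m] [Fintype l] (M : Matrix m l ℝ) : ℝ :=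
  Real.sqrt (∑ i, ∑ j, M i j ^ 2)

/-- Kronecker product of a family of square matrices (indexed functionally). -/
def kronFamily {r : Fin n → ℕ} (M : ∀ k, Matrix (Fin (r k)) (Fin (r k)) ℝ) :
    Matrix (∀ k, Fin (r k)) (∀ k, Fin (r k)) ℝ :=
  fun i j => ∏ k, M k (i k) (j k)

/-- The quantity `d_k + ∏_{j ≠ k} d_j`. -/
noncomputable def Dk (d : Fin n → ℕ) (k : Fin n) : ℝ :=
  (d k : ℝ) + ∏ j ∈ Finset.univ.erase k, (d j : ℝ)

/-- The vector `w_k = (h_k ∘ b_k)^{(2)}`. -/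
def wvec {d : Fin n → ℕ} (h b : ∀ j, Fin (d j) → ℝ) (k : Fin n) : Fin (d k) → ℝ :=
  fun ik => (h k ik * b k ik) ^ 2

/-- Law of a uniformly random `±1`-valued tensor (encoded by booleans). -/
noncomputable def signMeasure (ι : Type*) [Fintype ι] [DecidableEq ι] : Measure (ι → Bool) :=
  (PMF.uniformOfFintype (ι → Bool)).toMeasure

/-- Law of a random vector with i.i.d. entries equal to `1` with probability `1/4`,
`-1` with probability `1/4` and `0` with probability `1/2`. -/
noncomputable def xiMeasure (ι : Type*) [Fintype ι] [DecidableEq ι] : Measure (ι → ℝ) :=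
  ((PMF.uniformOfFintype (ι → Fin 4)).map
    (fun b i => (![0, 0, 1, -1] : Fin 4 → ℝ) (b i))).toMeasure

theorem frobNorm_eq_norm (X : Tensor d) :
    frobNorm X = ‖(WithLp.toLp 2 X : EuclideanSpace ℝ (Index d))‖ := by
  simp [frobNorm, EuclideanSpace.norm_eq]

theorem frobNorm_add_le (X Y : Tensor d) :
    frobNorm (fun i => X i + Y i) ≤ frobNorm X + frobNorm Y := by
  simp only [frobNorm_eq_norm]
  exact norm_add_le (WithLp.toLp 2 X : EuclideanSpace ℝ (Index d)) (WithLp.toLp 2 Y)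

theorem frobNorm_neg (X : Tensor d) : frobNorm (fun i => - X i) = frobNorm X := by
  simp [frobNorm]

theorem frobNorm_le_mul {X Y : Tensor d} {c : ℝ} (hc : 0 ≤ c)
    (h : ∀ i, |X i| ≤ c * |Y i|) : frobNorm X ≤ c * frobNorm Y := by
  unfold frobNorm
  rw [← Real.sqrt_sq hc, ← Real.sqrt_mul (sq_nonneg c), Finset.mul_sum]
  refine Real.sqrt_le_sqrt (Finset.sum_le_sum fun i _ => ?_)
  have := pow_le_pow_left₀ (abs_nonneg _) (h i) 2
  simpa [mul_pow] using this

theorem infNorm_nonneg (X : Tensor d) : 0 ≤ infNorm X :=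
  Real.iSup_nonneg fun _ => abs_nonneg _

theorem abs_le_infNorm (X : Tensor d) (i : Index d) : |X i| ≤ infNorm X :=
  le_ciSup (f := fun i => |X i|) (Set.finite_range _).bddAbove i

theorem frobNorm_indic_mul (Ω : Finset (Index d)) (z : Tensor d) :
    frobNorm (fun i => indic Ω i * z i) = Real.sqrt (∑ i ∈ Ω, z i ^ 2) := by
  simp [frobNorm, indic]

/-- Rescaling by an entrywise power of a positive rank-one tensor does not increase the CP rank. -/
theorem CPRankLE.epow_outer_mul {w : ∀ j, Fin (d j) → ℝ} (hpos : ∀ i, 0 < outer w i)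
    (α : ℝ) {T : Tensor d} {r : ℕ} (hT : CPRankLE T r) :
    CPRankLE (fun i => epow (outer w) α i * T i) r := by
  obtain ⟨v, rfl⟩ := hT
  refine ⟨fun s j k => |w j k| ^ α * v s j k, funext fun i => ?_⟩
  have h : epow (outer w) α i = ∏ j, |w j (i j)| ^ α := by
    simp only [epow]
    rw [← abs_of_pos (hpos i), outer, Finset.abs_prod,
      Real.finsetProd_rpow _ _ fun j _ => abs_nonneg _]
  simp only [h, Finset.mul_sum, Finset.prod_mul_distrib]

theorem epow_neg_half_le {W : Tensor d} (hWpos : ∀ i, 0 < W i) {Ω : Finset (Index d)} {μ : ℝ}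
    (hμ0 : 0 ≤ μ) (hμ : μ ^ 2 = ⨆ i ∈ Ω, 1 / W i) {i : Index d} (hi : i ∈ Ω) :
    epow W (-(1/2)) i ≤ μ := by
  have h1 : 1 / W i ≤ μ ^ 2 := by
    rw [hμ]
    have := le_ciSup (f := fun i => ⨆ _ : i ∈ Ω, 1 / W i) (Set.finite_range _).bddAbove i
    simpa [hi] using this
  refine (sq_le_sq₀ (Real.rpow_nonneg (hWpos i).le _) hμ0).1 (le_trans (le_of_eq ?_) h1)
  rw [← Real.rpow_natCast, ← Real.rpow_mul (hWpos i).le]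
  norm_num [Real.rpow_neg_one]

/-- The error of a best rank-`r` approximation is controlled by the noise on `Ω`. -/
theorem frobNorm_error_le {W : Tensor d} (hWpos : ∀ i, 0 < W i) {Ω : Finset (Index d)} {μ : ℝ}
    (hμ0 : 0 ≤ μ) (hμ : μ ^ 2 = ⨆ i ∈ Ω, 1 / W i) (T z X : Tensor d)
    (hX : frobNorm (fun i => X i - epow W (-(1/2)) i * (indic Ω i * (T i + z i))) ≤
      frobNorm (fun i => epow W (1/2) i * T i
        - epow W (-(1/2)) i * (indic Ω i * (T i + z i)))) :
    frobNorm (hadamard (epow W (1/2)) (fun i => T i - epow W (-(1/2)) i * X i)) ≤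
      2 * infNorm T * frobNorm (fun i => epow W (1/2) i - epow W (-(1/2)) i * indic Ω i)
        + 2 * μ * Real.sqrt (∑ i ∈ Ω, z i ^ 2) := by
  set A : Tensor d := fun i => epow W (-(1/2)) i * (indic Ω i * (T i + z i)) with hA
  have hcancel : ∀ i, epow W (1/2) i * epow W (-(1/2)) i = 1 := fun i => by
    simp only [epow]
    rw [← Real.rpow_add (hWpos i)]
    simp
  have hsplit : frobNorm (hadamard (epow W (1/2)) (fun i => T i - epow W (-(1/2)) i * X i)) ≤
      frobNorm (fun i => epow W (1/2) i * T i - A i) + frobNorm (fun i => X i - A i) := by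
    rw [← frobNorm_neg (fun i => X i - A i)]
    refine le_trans (le_of_eq (congrArg frobNorm (funext fun i => ?_))) (frobNorm_add_le _ _)
    simp only [hadamard]
    linear_combination (-X i) * hcancel i
  have hbias : frobNorm (fun i => T i * (epow W (1/2) i - epow W (-(1/2)) i * indic Ω i)) ≤
      infNorm T * frobNorm (fun i => epow W (1/2) i - epow W (-(1/2)) i * indic Ω i) :=
    frobNorm_le_mul (infNorm_nonneg T) fun i => by
      rw [abs_mul]
      exact mul_le_mul_of_nonneg_right (abs_le_infNorm T i) (abs_nonneg _)
  have hnoise : frobNorm (fun i => -(epow W (-(1/2)) i * (indic Ω i * z i))) ≤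
      μ * Real.sqrt (∑ i ∈ Ω, z i ^ 2) := by
    rw [frobNorm_neg, ← frobNorm_indic_mul]
    refine frobNorm_le_mul hμ0 fun i => ?_
    rw [abs_mul, abs_of_nonneg (show 0 ≤ epow W (-(1/2)) i from Real.rpow_nonneg (hWpos i).le _)]
    by_cases hi : i ∈ Ω
    · exact mul_le_mul_of_nonneg_right (epow_neg_half_le hWpos hμ0 hμ hi) (abs_nonneg _)
    · simp [indic, hi]
  have hA_le : frobNorm (fun i => epow W (1/2) i * T i - A i) ≤
      infNorm T * frobNorm (fun i => epow W (1/2) i - epow W (-(1/2)) i * indic Ω i)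
        + μ * Real.sqrt (∑ i ∈ Ω, z i ^ 2) := by
    refine le_trans (le_of_eq (congrArg frobNorm (funext fun i => ?_)))
      ((frobNorm_add_le _ _).trans (add_le_add hbias hnoise))
    simp only [hA]
    ring
  linarith

theorem integral_exp_sq_gaussianReal {σ : ℝ} (hσ : 0 < σ) :
    ∫ x, Real.exp (x ^ 2 / (4 * σ ^ 2)) ∂(gaussianReal 0 (σ ^ 2).toNNReal) = Real.sqrt 2 := by
  have hv : (σ ^ 2).toNNReal ≠ 0 := by
    simpa using hσ.ne'
  have hpi := Real.pi_pos
  rw [integral_gaussianReal_eq_integral_smul hv]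
  have h : ∀ x : ℝ, gaussianPDFReal 0 (σ ^ 2).toNNReal x • Real.exp (x ^ 2 / (4 * σ ^ 2)) =
      (Real.sqrt (2 * Real.pi * σ ^ 2))⁻¹ * Real.exp (-(1 / (4 * σ ^ 2)) * x ^ 2) := fun x => by
    rw [gaussianPDFReal, Real.coe_toNNReal _ (sq_nonneg σ), smul_eq_mul, mul_assoc, ← Real.exp_add]
    congr 2
    field_simp
    ring
  simp_rw [h]
  rw [integral_const_mul, integral_gaussian, ← Real.sqrt_inv, ← Real.sqrt_mul (by positivity)]
  congr 1
  field_simp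
  norm_num

instance (σ : ℝ) : IsProbabilityMeasure (gaussianTensor d σ) := by
  unfold gaussianTensor
  infer_instance

theorem integral_exp_sum_sq_gaussianTensor {σ : ℝ} (hσ : 0 < σ) (Ω : Finset (Index d)) :
    ∫ z, Real.exp ((∑ i ∈ Ω, z i ^ 2) / (4 * σ ^ 2)) ∂(gaussianTensor d σ) =
      Real.sqrt 2 ^ Ω.card := by
  let f : Index d → ℝ → ℝ := fun i x => if i ∈ Ω then Real.exp (x ^ 2 / (4 * σ ^ 2)) else 1
  have h : ∀ z : Tensor d, Real.exp ((∑ i ∈ Ω, z i ^ 2) / (4 * σ ^ 2)) =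
      ∏ i, f i (z i) := fun z => by
    simp [f, Finset.sum_div, Real.exp_sum, Finset.prod_ite_mem]
  rw [gaussianTensor, integral_congr_ae (Filter.Eventually.of_forall h),
    integral_fintype_prod_eq_prod (𝕜 := ℝ) f]
  have h2 : ∀ i : Index d, ∫ x, f i x
      ∂(gaussianReal 0 (σ ^ 2).toNNReal) = if i ∈ Ω then Real.sqrt 2 else 1 := fun i => by
    simp only [f]
    split_ifs
    · exact integral_exp_sq_gaussianReal hσ
    · simp
  simp [h2, Finset.prod_ite_mem]

/-- Chernoff tail bound for the squared norm of a Gaussian tensor restricted to `Ω`. -/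
theorem gaussianTensor_tail {σ : ℝ} (hσ : 0 < σ) (Ω : Finset (Index d)) :
    (gaussianTensor d σ).real
      {z | 4 * σ ^ 2 * (Ω.card * Real.log 2) ≤ ∑ i ∈ Ω, z i ^ 2} ≤
        (2 : ℝ) ^ (-(Ω.card : ℝ) / 2) := by
  have hint := integral_exp_sum_sq_gaussianTensor hσ Ω
  have hI : Integrable (fun z : Tensor d => Real.exp ((∑ i ∈ Ω, z i ^ 2) / (4 * σ ^ 2)))
      (gaussianTensor d σ) := by
    by_contra hn
    rw [integral_undef hn] at hint
    exact (pow_pos (Real.sqrt_pos.2 two_pos) _).ne hint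
  have hM := mul_meas_ge_le_integral_of_nonneg
    (Filter.Eventually.of_forall fun z => (Real.exp_pos _).le) hI ((2 : ℝ) ^ (Ω.card : ℝ))
  have hset : {z : Tensor d | (2 : ℝ) ^ (Ω.card : ℝ) ≤
        Real.exp ((∑ i ∈ Ω, z i ^ 2) / (4 * σ ^ 2))} =
      {z | 4 * σ ^ 2 * (Ω.card * Real.log 2) ≤ ∑ i ∈ Ω, z i ^ 2} := by
    ext z
    simp only [Set.mem_ofPred_eq]
    rw [Real.rpow_def_of_pos two_pos, Real.exp_le_exp, le_div_iff₀ (by positivity),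
      mul_comm (Real.log 2), mul_comm (4 * σ ^ 2)]
  rw [hset, hint, Real.sqrt_eq_rpow, ← Real.rpow_natCast (2 ^ (1 / 2 : ℝ)), ← Real.rpow_mul two_pos.le] at hM
  rw [← le_div_iff₀' (by positivity), ← Real.rpow_sub two_pos] at hM
  refine hM.trans (le_of_eq ?_)
  congr 1
  ring

theorem general_upper_bound_cp
    {n : ℕ} {d : Fin n → ℕ} (w : ∀ j, Fin (d j) → ℝ) (W : Tensor d)
    (hW : W = outer w) (hWpos : ∀ i, 0 < W i)
    (Ω : Finset (Index d)) (r : ℕ) (σ : ℝ) (hσ : 0 < σ)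
    (T : Tensor d) (hT : CPRankLE T r)
    (μ : ℝ) (hμ0 : 0 ≤ μ) (hμ : μ ^ 2 = ⨆ i ∈ Ω, 1 / W i)
    (Xhat : Tensor d → Tensor d)
    (hmin : ∀ z : Tensor d, CPRankLE (Xhat z) r ∧
      ∀ X : Tensor d, CPRankLE X r →
        frobNorm (fun i => Xhat z i - epow W (-(1/2)) i * (indic Ω i * (T i + z i)))
          ≤ frobNorm (fun i => X i - epow W (-(1/2)) i * (indic Ω i * (T i + z i)))) :
    ENNReal.ofReal (1 - (2 : ℝ) ^ (-(Ω.card : ℝ) / 2)) ≤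
      gaussianTensor d σ {z : Tensor d |
        frobNorm (hadamard (epow W (1/2)) (fun i => T i - epow W (-(1/2)) i * Xhat z i)) ≤
          2 * infNorm T *
              frobNorm (fun i => epow W (1/2) i - epow W (-(1/2)) i * indic Ω i)
            + 4 * σ * μ * Real.sqrt ((Ω.card : ℝ) * Real.log 2)} := by
  subst hW
  set B : Set (Tensor d) := {z | 4 * σ ^ 2 * (Ω.card * Real.log 2) ≤ ∑ i ∈ Ω, z i ^ 2} with hB
  have hBmeas : MeasurableSet B := measurableSet_le (by fun_prop) (by fun_prop)
  have hgood : ENNReal.ofReal (1 - (2 : ℝ) ^ (-(Ω.card : ℝ) / 2)) ≤ gaussianTensor d σ Bᶜ := by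
    rw [← ofReal_measureReal, probReal_compl_eq_one_sub hBmeas]
    exact ENNReal.ofReal_le_ofReal (sub_le_sub_left (gaussianTensor_tail hσ Ω) _)
  refine hgood.trans (measure_mono fun z hz => ?_)
  have hz' : ∑ i ∈ Ω, z i ^ 2 ≤ (2 * σ) ^ 2 * (Ω.card * Real.log 2) := by
    rw [hB, Set.mem_compl_iff, Set.mem_ofPred_eq, not_le] at hz
    linarith
  have hsqrt : Real.sqrt (∑ i ∈ Ω, z i ^ 2) ≤ 2 * σ * Real.sqrt (Ω.card * Real.log 2) := by
    refine (Real.sqrt_le_sqrt hz').trans (le_of_eq ?_)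
    rw [Real.sqrt_mul (sq_nonneg _), Real.sqrt_sq (by positivity)]
  refine (frobNorm_error_le hWpos hμ0 hμ T z (Xhat z)
    ((hmin z).2 _ (hT.epow_outer_mul hWpos (1/2)))).trans ?_
  have := mul_le_mul_of_nonneg_left hsqrt (mul_nonneg zero_le_two hμ0)
  linarith

end WTC
end

section
/- Let W ∈ ℝ^{d₁×⋯×dₙ} have strictly positive entries, let Ω ⊆ [d₁]×⋯×[dₙ], let T, Z ∈ ℝ^{d₁×⋯×dₙ} be arbitrary tensors, and set Y_Ω = 1_Ω∘(T+Z). Suppose X̂ ∈ ℝ^{d₁×⋯×dₙ} satisfies ‖X̂ − W^{(−1/2)}∘Y_Ω‖_F ≤ ‖W^{(1/2)}∘T − W^{(−1/2)}∘Y_Ω‖_F, and set T̂ = W^{(−1/2)}∘X̂. Then ‖W^{(1/2)}∘(T−T̂)‖_F ≤ 2‖T‖_∞·‖W^{(1/2)} − W^{(−1/2)}∘1_Ω‖_F + 2‖W^{(−1/2)}∘Z_Ω‖_F. -/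
open MeasureTheory ProbabilityTheory Matrix
open scoped BigOperators ENNReal

namespace WTC

variable {n : ℕ}

variable {d : Fin n → ℕ}

theorem frobNorm_eq_norm_toLp (X : Tensor d) : frobNorm X = ‖WithLp.toLp 2 X‖ := by
  simp [frobNorm, EuclideanSpace.norm_eq]

theorem frobNorm_sub_le (X Y : Tensor d) : frobNorm (X - Y) ≤ frobNorm X + frobNorm Y := by
  simpa only [frobNorm_eq_norm_toLp, WithLp.toLp_sub] using norm_sub_le _ _

theorem frobNorm_hadamard_le (X Y : Tensor d) :
    frobNorm (hadamard X Y) ≤ infNorm X * frobNorm Y := by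
  unfold frobNorm
  rw [← Real.sqrt_sq (infNorm_nonneg X), ← Real.sqrt_mul (sq_nonneg _), Finset.mul_sum]
  refine Real.sqrt_le_sqrt (Finset.sum_le_sum fun i _ => ?_)
  rw [hadamard, mul_pow, ← sq_abs (X i)]
  gcongr
  exact abs_le_infNorm X i

theorem deterministic_upper_bound
    {n : ℕ} {d : Fin n → ℕ} (W : Tensor d) (hWpos : ∀ i, 0 < W i)
    (Ω : Finset (Index d)) (T Z : Tensor d) (Xhat : Tensor d)
    (hXhat : frobNorm (fun i => Xhat i - epow W (-(1/2)) i * (indic Ω i * (T i + Z i)))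
      ≤ frobNorm (fun i => epow W (1/2) i * T i - epow W (-(1/2)) i * (indic Ω i * (T i + Z i)))) :
    frobNorm (hadamard (epow W (1/2)) (fun i => T i - epow W (-(1/2)) i * Xhat i)) ≤
      2 * infNorm T * frobNorm (fun i => epow W (1/2) i - epow W (-(1/2)) i * indic Ω i)
        + 2 * frobNorm (hadamard (epow W (-(1/2))) (fun i => indic Ω i * Z i)) := by
  set Y : Tensor d := fun i => epow W (-(1/2)) i * (indic Ω i * (T i + Z i))
  set A : Tensor d := fun i => epow W (1/2) i * T i - Y i
  set D : Tensor d := fun i => epow W (1/2) i - epow W (-(1/2)) i * indic Ω i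
  set N : Tensor d := hadamard (epow W (-(1/2))) (fun i => indic Ω i * Z i)
  have hsplit : hadamard (epow W (1/2)) (fun i => T i - epow W (-(1/2)) i * Xhat i)
      = A - fun i => Xhat i - Y i := by
    ext i
    have hpow : epow W (1/2) i * epow W (-(1/2)) i = 1 := by
      simp only [epow, ← Real.rpow_add (hWpos i)]
      norm_num
    simp only [hadamard, A, Pi.sub_apply]
    linear_combination (-Xhat i) * hpow
  have hA : A = hadamard T D - N := by
    ext i
    simp only [hadamard, A, Y, D, N, Pi.sub_apply]
    ring
  have hA_le : frobNorm A ≤ infNorm T * frobNorm D + frobNorm N := by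
    rw [hA]
    exact (frobNorm_sub_le _ _).trans (by gcongr; exact frobNorm_hadamard_le T D)
  rw [hsplit]
  linarith [frobNorm_sub_le A fun i => Xhat i - Y i]

end WTC
end

section
/- Let M, N ∈ ℝ^{p×q} with rank(M) ≤ r, and let Û ∈ ℝ^{p×r} have orthonormal columns and satisfy ‖N − ÛÛᵀN‖₂ ≤ ‖N − B‖₂ for every matrix B ∈ ℝ^{p×q} of rank at most r. Then ‖M − ÛÛᵀM‖₂ ≤ 3‖M − N‖₂. -/
open MeasureTheory ProbabilityTheory Matrix
open scoped BigOperators ENNReal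

namespace WTC

variable {n : ℕ}

variable {d : Fin n → ℕ}

open scoped Matrix.Norms.L2Operator in
theorem specNorm_eq_l2_opNorm {m l : Type*} [Fintype m] [Fintype l] [DecidableEq l]
    (A : Matrix m l ℝ) : specNorm A = ‖A‖ :=
  rfl

open scoped Matrix.Norms.L2Operator in
theorem l2_opNorm_le_one_of_transpose_mul_self {m : Type*} [Fintype m] [DecidableEq m]
    {P : Matrix m m ℝ} (hP : Pᵀ * P = P) : ‖P‖ ≤ 1 := by
  have h := l2_opNorm_conjTranspose_mul_self P
  rw [conjTranspose_eq_transpose_of_trivial, hP] at h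
  nlinarith [norm_nonneg P]

open scoped Matrix.Norms.L2Operator in
theorem projection_spectral_bound
    {p q r : ℕ} (M N : Matrix (Fin p) (Fin q) ℝ) (hM : M.rank ≤ r)
    (U : Matrix (Fin p) (Fin r) ℝ) (hU : Uᵀ * U = 1)
    (hopt : ∀ B : Matrix (Fin p) (Fin q) ℝ, B.rank ≤ r →
      specNorm (N - U * Uᵀ * N) ≤ specNorm (N - B)) :
    specNorm (M - U * Uᵀ * M) ≤ 3 * specNorm (M - N) := by
  simp only [specNorm_eq_l2_opNorm] at hopt ⊢
  have hP : ‖1 - U * Uᵀ‖ ≤ 1 := by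
    apply l2_opNorm_le_one_of_transpose_mul_self
    have hPP : U * Uᵀ * (U * Uᵀ) = U * Uᵀ := by
      rw [Matrix.mul_assoc, ← Matrix.mul_assoc Uᵀ, hU, Matrix.one_mul]
    simp [Matrix.mul_sub, Matrix.sub_mul, hPP]
  have hdecomp : M - U * Uᵀ * M = (1 - U * Uᵀ) * (M - N) + (N - U * Uᵀ * N) := by
    rw [Matrix.sub_mul, Matrix.one_mul, Matrix.mul_sub]
    abel
  calc ‖M - U * Uᵀ * M‖ ≤ ‖(1 - U * Uᵀ) * (M - N)‖ + ‖N - U * Uᵀ * N‖ :=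
        hdecomp ▸ norm_add_le _ _
    _ ≤ 1 * ‖M - N‖ + ‖M - N‖ := by
        gcongr
        · exact (l2_opNorm_mul _ _).trans (by gcongr)
        · exact (hopt M hM).trans_eq (norm_sub_rev _ _)
    _ ≤ 3 * ‖M - N‖ := by linarith [norm_nonneg (M - N)]

end WTC
end

section
/- Let W ∈ ℝ^{d₁×⋯×dₙ} have strictly positive entries, let Ω ⊆ [d₁]×⋯×[dₙ], let Z have i.i.d. entries Z_{i₁⋯iₙ} ∼ N(0,σ²), and fix k ∈ {1,…,n}. Set μ_k² = max{ max_{i_k} Σ_{i₁,…,i_{k−1},i_{k+1},…,iₙ} 1_{(i₁,…,iₙ)∈Ω}/W_{i₁⋯iₙ}, max_{i₁,…,i_{k−1},i_{k+1},…,iₙ} Σ_{i_k} 1_{(i₁,…,iₙ)∈Ω}/W_{i₁⋯iₙ} }. Then for every t > 0, P( ‖(W^{(−1/2)}∘Z_Ω)_{(k)}‖₂ ≥ t ) ≤ (d_k + ∏_{j≠k}d_j)·exp(−t²/(2σ²μ_k²)); in particular, with probability at least 1 − 1/(d_k + ∏_{j≠k}d_j), ‖(W^{(−1/2)}∘Z_Ω)_{(k)}‖₂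 ≤ 2σμ_k√(log(d_k + ∏_{j≠k}d_j)). -/
open MeasureTheory ProbabilityTheory Matrix
open scoped BigOperators ENNReal

namespace WTC

variable {n : ℕ}

variable {d : Fin n → ℕ}

section GaussianIntegrationByParts

open scoped NNReal

lemma integrable_pow_gaussianReal (s : ℝ≥0) (m : ℕ) :
    Integrable (fun x : ℝ => x ^ m) (gaussianReal 0 s) := by
  rcases Nat.eq_zero_or_pos m with rfl | hm
  · simp
  · have h := (memLp_id_gaussianReal (μ := 0) (v := s) (m : ℝ≥0)).integrable_norm_pow hm.ne'
    refine (integrable_norm_iff (by fun_prop)).1 (h.congr (ae_of_all _ fun x => ?_))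
    simp

lemma hasDerivAt_gaussianPDFReal {s : ℝ≥0} (hs : s ≠ 0) (x : ℝ) :
    HasDerivAt (fun y => -(s : ℝ) * gaussianPDFReal 0 s y) (x * gaussianPDFReal 0 s x) x := by
  have hs' : (s : ℝ) ≠ 0 := by exact_mod_cast hs
  simp only [gaussianPDFReal, sub_zero]
  have h : HasDerivAt (fun y : ℝ => -y ^ 2 / (2 * s)) (-x / s) x := by
    convert! ((hasDerivAt_pow 2 x).neg.div_const (2 * (s : ℝ))) using 1
    simp; field_simp
  convert! (h.exp.const_mul (√(2 * Real.pi * s))⁻¹).const_mul (-(s : ℝ)) using 1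
  field_simp

/-- Gaussian integration by parts for monomials. -/
lemma integral_mul_pow_gaussianReal {s : ℝ≥0} (hs : s ≠ 0) (m : ℕ) :
    ∫ x, x ^ (m + 1) ∂gaussianReal 0 s = s * (m * ∫ x, x ^ (m - 1) ∂gaussianReal 0 s) := by
  have hInt : ∀ j : ℕ, Integrable (fun x : ℝ => gaussianPDFReal 0 s x * x ^ j) := fun j => by
    have h := integrable_pow_gaussianReal s j
    rw [gaussianReal_of_var_ne_zero _ hs, integrable_withDensity_iff_integrable_smul'
      (measurable_gaussianPDF _ _) (ae_of_all _ fun _ => gaussianPDF_lt_top)] at h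
    simpa using h
  have key := integral_mul_deriv_eq_deriv_mul_of_integrable
    (u := fun x : ℝ => x ^ m) (v := fun y => -(s : ℝ) * gaussianPDFReal 0 s y)
    (u' := fun x => m * x ^ (m - 1)) (v' := fun x => x * gaussianPDFReal 0 s x)
    (fun x _ => hasDerivAt_pow m x) (fun x _ => hasDerivAt_gaussianPDFReal hs x)
    ((hInt (m + 1)).congr (ae_of_all _ fun x => by simp; ring))
    (((hInt (m - 1)).const_mul (-(s * m : ℝ))).congr (ae_of_all _ fun x => by simp; ring))
    (((hInt m).const_mul (-(s : ℝ))).congr (ae_of_all _ fun x => by simp; ring))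
  simp only [integral_gaussianReal_eq_integral_smul hs, smul_eq_mul]
  calc ∫ x, gaussianPDFReal 0 s x * x ^ (m + 1)
      = ∫ x, x ^ m * (x * gaussianPDFReal 0 s x) := by congr 1; ext x; ring
    _ = _ := by
      rw [key, ← integral_neg, ← integral_const_mul, ← integral_const_mul]
      congr 1; ext x; ring

variable {ι : Type*} [Fintype ι]

lemma integrable_eval_gaussian (s : ℝ≥0) (P : MvPolynomial ι ℝ) :
    Integrable (fun z : ι → ℝ => MvPolynomial.eval z P)
      (Measure.pi fun _ : ι => gaussianReal 0 s) := by
  induction P using MvPolynomial.induction_on' with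
  | monomial m a =>
    simp only [MvPolynomial.eval_monomial, Finsupp.prod_pow]
    exact (Integrable.fintype_prod (f := fun i (x : ℝ) => x ^ m i)
      fun i => integrable_pow_gaussianReal s (m i)).const_mul a
  | add p q hp hq => simpa using! hp.add hq

/-- Gaussian integration by parts for polynomials in several independent variables. -/
lemma integral_X_mul_gaussian {s : ℝ≥0} (hs : s ≠ 0) (i : ι) (P : MvPolynomial ι ℝ) :
    ∫ z, MvPolynomial.eval z (MvPolynomial.X i * P) ∂(Measure.pi fun _ : ι => gaussianReal 0 s)
      = s * ∫ z, MvPolynomial.eval z (MvPolynomial.pderiv i P)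
          ∂(Measure.pi fun _ : ι => gaussianReal 0 s) := by
  classical
  induction P using MvPolynomial.induction_on' with
  | monomial m a =>
    rw [MvPolynomial.X, MvPolynomial.monomial_mul, MvPolynomial.pderiv_monomial]
    simp only [MvPolynomial.eval_monomial, Finsupp.prod_pow, integral_const_mul]
    have hprod : ∀ r : ι →₀ ℕ,
        ∫ z : ι → ℝ, ∏ j, z j ^ r j ∂(Measure.pi fun _ => gaussianReal 0 s)
          = ∏ j, ∫ x, x ^ r j ∂gaussianReal 0 s := fun r =>
      integral_fintype_prod_eq_prod (f := fun j (x : ℝ) => x ^ r j)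
    rw [hprod, hprod, ← Finset.mul_prod_erase _ _ (Finset.mem_univ i),
      ← Finset.mul_prod_erase Finset.univ
        (fun j => ∫ x, x ^ (m - Finsupp.single i 1 : ι →₀ ℕ) j ∂gaussianReal 0 s)
        (Finset.mem_univ i)]
    have h1 : (Finsupp.single i 1 + m : ι →₀ ℕ) i = m i + 1 := by simp [add_comm]
    have h2 : (m - Finsupp.single i 1 : ι →₀ ℕ) i = m i - 1 := by simp
    rw [h1, h2, integral_mul_pow_gaussianReal hs]
    have h3 : ∀ j ∈ Finset.univ.erase i,
        ∫ x, x ^ (Finsupp.single i 1 + m : ι →₀ ℕ) j ∂gaussianReal 0 s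
        = ∫ x, x ^ (m - Finsupp.single i 1 : ι →₀ ℕ) j ∂gaussianReal 0 s := fun j hj => by
      have : i ≠ j := (Finset.ne_of_mem_erase hj).symm
      simp [this]
    rw [Finset.prod_congr rfl h3]
    ring
  | add p q hp hq =>
    simp only [mul_add, map_add]
    rw [integral_add (integrable_eval_gaussian s _) (integrable_eval_gaussian s _),
      integral_add (integrable_eval_gaussian s _) (integrable_eval_gaussian s _), hp, hq]
    ring

end GaussianIntegrationByParts

section TraceInequalities

variable {κ : Type*} [Fintype κ] [DecidableEq κ]

lemma pow_mul_pow_add_le {a b : ℝ} {q r p : ℕ} (h : q + r = 2 * p) :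
    a ^ q * b ^ r + b ^ q * a ^ r ≤ a ^ (2 * p) + b ^ (2 * p) := by
  have key : 0 ≤ (a ^ q - b ^ q) * (a ^ r - b ^ r) := by
    rcases Nat.even_or_odd q with hq | hq
    · have hr : Even r := by grind
      rw [← hq.pow_abs, ← hq.pow_abs b, ← hr.pow_abs, ← hr.pow_abs b]
      rcases le_total |a| |b| with hab | hab
      · exact mul_nonneg_of_nonpos_of_nonpos
          (sub_nonpos.2 (by gcongr)) (sub_nonpos.2 (by gcongr))
      · exact mul_nonneg (sub_nonneg.2 (by gcongr)) (sub_nonneg.2 (by gcongr))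
    · have hr : Odd r := by grind
      rcases le_total a b with hab | hab
      · exact mul_nonneg_of_nonpos_of_nonpos
          (sub_nonpos.2 (hq.pow_le_pow.2 hab)) (sub_nonpos.2 (hr.pow_le_pow.2 hab))
      · exact mul_nonneg (sub_nonneg.2 (hq.pow_le_pow.2 hab)) (sub_nonneg.2 (hr.pow_le_pow.2 hab))
  rw [← h, pow_add, pow_add]
  nlinarith

lemma trace_mul_diagonal_mul_diagonal_le {B : Matrix κ κ ℝ} (hB : B.IsHermitian) (l : κ → ℝ)
    {q r p : ℕ} (h : q + r = 2 * p) :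
    (B * diagonal l ^ q * B * diagonal l ^ r).trace ≤ (B * B * diagonal l ^ (2 * p)).trace := by
  have hsymm : ∀ j k, B j k = B k j := fun j k => by simpa using (hB.apply j k).symm
  have e1 : (B * diagonal l ^ q * B * diagonal l ^ r).trace
      = ∑ j, ∑ k, B j k ^ 2 * (l k ^ q * l j ^ r) := by
    simp only [diagonal_pow, trace, diag_apply, mul_diagonal, mul_apply (M := B * _), Pi.pow_apply,
      Finset.sum_mul]
    refine Finset.sum_congr rfl fun j _ => Finset.sum_congr rfl fun k _ => ?_
    rw [hsymm k j]; ring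
  have e2 : (B * B * diagonal l ^ (2 * p)).trace = ∑ j, ∑ k, B j k ^ 2 * l j ^ (2 * p) := by
    simp only [diagonal_pow, trace, diag_apply, mul_diagonal, mul_apply (M := B), Pi.pow_apply,
      Finset.sum_mul]
    refine Finset.sum_congr rfl fun j _ => Finset.sum_congr rfl fun k _ => ?_
    rw [hsymm k j]; ring
  have e1' : (B * diagonal l ^ q * B * diagonal l ^ r).trace
      = ∑ j, ∑ k, B j k ^ 2 * (l j ^ q * l k ^ r) := by
    rw [e1, Finset.sum_comm]
    exact Finset.sum_congr rfl fun j _ => Finset.sum_congr rfl fun k _ => by rw [hsymm k j]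
  have e2' : (B * B * diagonal l ^ (2 * p)).trace = ∑ j, ∑ k, B j k ^ 2 * l k ^ (2 * p) := by
    rw [e2, Finset.sum_comm]
    exact Finset.sum_congr rfl fun j _ => Finset.sum_congr rfl fun k _ => by rw [hsymm k j]
  have hle : ∑ j, ∑ k, (B j k ^ 2 * (l k ^ q * l j ^ r) + B j k ^ 2 * (l j ^ q * l k ^ r))
      ≤ ∑ j, ∑ k, (B j k ^ 2 * l j ^ (2 * p) + B j k ^ 2 * l k ^ (2 * p)) := by
    refine Finset.sum_le_sum fun j _ => Finset.sum_le_sum fun k _ => ?_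
    rw [← mul_add, ← mul_add]
    refine mul_le_mul_of_nonneg_left ?_ (sq_nonneg _)
    linarith [pow_mul_pow_add_le (a := l k) (b := l j) h]
  simp only [Finset.sum_add_distrib] at hle
  rw [← e1, ← e1', ← e2, ← e2'] at hle
  linarith

lemma trace_mul_pow_mul_pow_le {A H : Matrix κ κ ℝ} (hA : A.IsHermitian) (hH : H.IsHermitian)
    {q r p : ℕ} (h : q + r = 2 * p) :
    (A * H ^ q * A * H ^ r).trace ≤ (A * A * H ^ (2 * p)).trace := by
  obtain ⟨U, V, l, hVU, hUV, hUH, hdiag⟩ : ∃ (U V : Matrix κ κ ℝ) (l : κ → ℝ),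
      V * U = 1 ∧ U * V = 1 ∧ Uᴴ = V ∧ H = U * diagonal l * V := by
    refine ⟨hH.eigenvectorUnitary, star (hH.eigenvectorUnitary : Matrix κ κ ℝ), hH.eigenvalues,
      by simp, by simp, rfl, ?_⟩
    conv_lhs => rw [hH.spectral_theorem]
    rfl
  have hpow : ∀ m, H ^ m = U * diagonal l ^ m * V := fun m => by
    induction m with
    | zero => simp [hUV]
    | succ m ih =>
      rw [pow_succ, ih, hdiag, pow_succ]
      calc U * diagonal l ^ m * V * (U * diagonal l * V)
          = U * diagonal l ^ m * (V * U) * diagonal l * V := by noncomm_ring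
        _ = _ := by rw [hVU]; noncomm_ring
  have hB : (V * A * U).IsHermitian := by
    have hVH : Vᴴ = U := by rw [← hUH, conjTranspose_conjTranspose]
    rw [IsHermitian, conjTranspose_mul, conjTranspose_mul, hUH, hVH, hA.eq, mul_assoc]
  have e1 : (A * H ^ q * A * H ^ r).trace
      = (V * A * U * diagonal l ^ q * (V * A * U) * diagonal l ^ r).trace := by
    rw [hpow, hpow, ← mul_assoc, trace_mul_comm]
    congr 1
    noncomm_ring
  have e2 : (A * A * H ^ (2 * p)).trace
      = (V * A * U * (V * A * U) * diagonal l ^ (2 * p)).trace := by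
    rw [hpow, ← mul_assoc, trace_mul_comm]
    congr 1
    calc V * (A * A * (U * diagonal l ^ (2 * p))) = V * A * 1 * A * U * diagonal l ^ (2 * p) := by
          noncomm_ring
      _ = _ := by rw [← hUV]; noncomm_ring
  rw [e1, e2]
  exact trace_mul_diagonal_mul_diagonal_le hB l h

lemma trace_mul_pow_le_of_posSemidef {S H : Matrix κ κ ℝ} {v : ℝ} (hS : (v • 1 - S).PosSemidef)
    (hH : H.IsHermitian) (p : ℕ) :
    (S * H ^ (2 * p)).trace ≤ v * (H ^ (2 * p)).trace := by
  have h := (hS.conjTranspose_mul_mul_same (H ^ p)).trace_nonneg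
  rw [(hH.pow p).eq, mul_assoc, trace_mul_comm, mul_assoc, ← pow_add, ← two_mul, sub_mul,
    trace_sub, smul_mul_assoc, one_mul, trace_smul, smul_eq_mul] at h
  linarith

end TraceInequalities

section MatrixSeriesMoments

open scoped NNReal

variable {ι κ : Type*}

lemma map_pderiv_mul [Fintype κ] (i : ι) (M N : Matrix κ κ (MvPolynomial ι ℝ)) :
    (M * N).map (MvPolynomial.pderiv i)
      = M.map (MvPolynomial.pderiv i) * N + M * N.map (MvPolynomial.pderiv i) := by
  ext a b
  simp only [map_apply, mul_apply, Matrix.add_apply, map_sum, Derivation.leibniz, smul_eq_mul,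
    Finset.sum_add_distrib]
  rw [add_comm, Finset.sum_congr rfl fun x _ => mul_comm (N x b) _]

lemma map_pderiv_pow [Fintype κ] [DecidableEq κ]
    (i : ι) (M : Matrix κ κ (MvPolynomial ι ℝ)) (m : ℕ) :
    (M ^ (m + 1)).map (MvPolynomial.pderiv i)
      = ∑ q ∈ Finset.range (m + 1), M ^ q * M.map (MvPolynomial.pderiv i) * M ^ (m - q) := by
  induction m with
  | zero => simp
  | succ m ih =>
    rw [pow_succ, map_pderiv_mul, ih, Finset.sum_range_succ _ (m + 1), Finset.sum_mul]
    refine congrArg₂ (· + ·) ?_ ?_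
    · refine Finset.sum_congr rfl fun q hq => ?_
      rw [mul_assoc _ (M ^ (m - q)), ← pow_succ,
        ← Nat.sub_add_comm (Nat.le_of_lt_succ (Finset.mem_range.1 hq))]
    · simp

/-- The linear matrix pencil `∑ i, X i • A i` with polynomial entries. -/
noncomputable def pencil [Fintype ι] (A : ι → Matrix κ κ ℝ) : Matrix κ κ (MvPolynomial ι ℝ) :=
  ∑ i, (MvPolynomial.X i : MvPolynomial ι ℝ) • (A i).map MvPolynomial.C

lemma map_eval_pencil [Fintype ι] [Fintype κ] [DecidableEq κ] (A : ι → Matrix κ κ ℝ) (z : ι → ℝ) :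
    (MvPolynomial.eval z).mapMatrix (pencil A) = ∑ i, z i • A i := by
  ext a b
  simp [pencil, Matrix.sum_apply]

lemma map_eval_map_C [Fintype κ] [DecidableEq κ] (M : Matrix κ κ ℝ) (z : ι → ℝ) :
    (MvPolynomial.eval z).mapMatrix (M.map MvPolynomial.C) = M := by
  ext a b
  simp

lemma map_pderiv_pencil [Fintype ι] (A : ι → Matrix κ κ ℝ) (i : ι) :
    (pencil A).map (MvPolynomial.pderiv i) = (A i).map MvPolynomial.C := by
  classical
  ext a b
  simp [pencil, Matrix.sum_apply, MvPolynomial.pderiv_X, Pi.single_apply]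

lemma pderiv_trace [Fintype κ] (i : ι) (M : Matrix κ κ (MvPolynomial ι ℝ)) :
    MvPolynomial.pderiv i M.trace = (M.map (MvPolynomial.pderiv i)).trace := by
  simp [trace]

lemma eval_trace [Fintype κ] [DecidableEq κ] (z : ι → ℝ) (M : Matrix κ κ (MvPolynomial ι ℝ)) :
    MvPolynomial.eval z M.trace = ((MvPolynomial.eval z).mapMatrix M).trace := by
  simp [trace]

lemma trace_pencil_pow_succ [Fintype ι] [Fintype κ] [DecidableEq κ]
    (A : ι → Matrix κ κ ℝ) (m : ℕ) :
    (pencil A ^ (m + 1)).trace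
      = ∑ i, MvPolynomial.X i * ((A i).map MvPolynomial.C * pencil A ^ m).trace := by
  rw [pow_succ']
  conv_lhs => enter [1, 1]; rw [pencil]
  simp [Finset.sum_mul, trace_sum]

lemma pderiv_trace_mul_pencil_pow [Fintype ι] [Fintype κ] [DecidableEq κ]
    (A : ι → Matrix κ κ ℝ) (i : ι) (m : ℕ) :
    MvPolynomial.pderiv i ((A i).map MvPolynomial.C * pencil A ^ (m + 1)).trace
      = ∑ q ∈ Finset.range (m + 1), ((A i).map MvPolynomial.C * pencil A ^ q
          * (A i).map MvPolynomial.C * pencil A ^ (m - q)).trace := by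
  have h0 : ((A i).map (MvPolynomial.C : ℝ →+* MvPolynomial ι ℝ)).map (MvPolynomial.pderiv i)
      = 0 := by
    ext a b
    simp
  rw [pderiv_trace, map_pderiv_mul, h0, zero_mul, zero_add, map_pderiv_pow, map_pderiv_pencil,
    Finset.mul_sum, trace_sum]
  simp only [mul_assoc]

lemma integrable_trace_series_pow [Fintype ι] [Fintype κ] [DecidableEq κ]
    (s : ℝ≥0) (A : ι → Matrix κ κ ℝ) (m : ℕ) :
    Integrable (fun z : ι → ℝ => ((∑ i, z i • A i) ^ m).trace)
      (Measure.pi fun _ : ι => gaussianReal 0 s) := by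
  refine (integrable_eval_gaussian s (pencil A ^ m).trace).congr (ae_of_all _ fun z => ?_)
  simp only [eval_trace, map_pow, map_eval_pencil]

lemma isHermitian_series [Fintype ι] {A : ι → Matrix κ κ ℝ}
    (hA : ∀ i, (A i).IsHermitian) (z : ι → ℝ) :
    (∑ i, z i • A i).IsHermitian := by
  simp only [IsHermitian, conjTranspose_sum, conjTranspose_smul, star_trivial, (hA _).eq]

lemma integral_trace_series_pow_succ_le [Fintype ι] [Fintype κ] [DecidableEq κ] {s : ℝ≥0}
    (hs : s ≠ 0) {A : ι → Matrix κ κ ℝ} (hA : ∀ i, (A i).IsHermitian) {v : ℝ}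
    (hv : (v • 1 - ∑ i, A i * A i).PosSemidef) (p : ℕ) :
    ∫ z, ((∑ i, z i • A i) ^ (2 * (p + 1))).trace ∂(Measure.pi fun _ : ι => gaussianReal 0 s)
      ≤ (2 * p + 1) * (s * v) * ∫ z, ((∑ i, z i • A i) ^ (2 * p)).trace
          ∂(Measure.pi fun _ : ι => gaussianReal 0 s) := by
  have hpt : ∀ z : ι → ℝ,
      ∑ i, MvPolynomial.eval z (MvPolynomial.pderiv i
        ((A i).map MvPolynomial.C * pencil A ^ (2 * p + 1)).trace)
      ≤ (2 * p + 1) * v * ((∑ i, z i • A i) ^ (2 * p)).trace := fun z => by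
    have hH := isHermitian_series hA z
    simp only [pderiv_trace_mul_pencil_pow, map_sum, eval_trace, map_mul, map_pow,
      map_eval_map_C, map_eval_pencil]
    set H := ∑ i, z i • A i with hHdef
    calc ∑ i, ∑ q ∈ Finset.range (2 * p + 1), (A i * H ^ q * A i * H ^ (2 * p - q)).trace
        ≤ ∑ i, ∑ q ∈ Finset.range (2 * p + 1), (A i * A i * H ^ (2 * p)).trace := by
          refine Finset.sum_le_sum fun i _ => Finset.sum_le_sum fun q hq => ?_
          have := Finset.mem_range.1 hq
          exact trace_mul_pow_mul_pow_le (hA i) hH (by omega)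
      _ = (2 * p + 1) * ((∑ i, A i * A i) * H ^ (2 * p)).trace := by
          simp [Finset.sum_mul, trace_sum, Finset.mul_sum]
      _ ≤ (2 * p + 1) * v * (H ^ (2 * p)).trace := by
          rw [mul_assoc]
          exact mul_le_mul_of_nonneg_left (trace_mul_pow_le_of_posSemidef hv hH p) (by positivity)
  calc ∫ z, ((∑ i, z i • A i) ^ (2 * (p + 1))).trace ∂(Measure.pi fun _ : ι => gaussianReal 0 s)
      = ∫ z, ∑ i, MvPolynomial.eval z (MvPolynomial.X i *
          ((A i).map MvPolynomial.C * pencil A ^ (2 * p + 1)).trace)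
          ∂(Measure.pi fun _ : ι => gaussianReal 0 s) := by
        congr 1; ext z
        rw [← map_sum, ← trace_pencil_pow_succ, eval_trace, map_pow, map_eval_pencil]
        rfl
    _ = s * ∫ z, ∑ i, MvPolynomial.eval z (MvPolynomial.pderiv i
          ((A i).map MvPolynomial.C * pencil A ^ (2 * p + 1)).trace)
          ∂(Measure.pi fun _ : ι => gaussianReal 0 s) := by
        rw [integral_finsetSum _ fun i _ => integrable_eval_gaussian s _,
          integral_finsetSum _ fun i _ => integrable_eval_gaussian s _, Finset.mul_sum]
        exact Finset.sum_congr rfl fun i _ => integral_X_mul_gaussian hs i _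
    _ ≤ s * ∫ z, (2 * p + 1) * v * ((∑ i, z i • A i) ^ (2 * p)).trace
          ∂(Measure.pi fun _ : ι => gaussianReal 0 s) := by
        refine mul_le_mul_of_nonneg_left (integral_mono
          (integrable_finsetSum _ fun i _ => integrable_eval_gaussian s _)
          ((integrable_trace_series_pow s A _).const_mul _) hpt) s.2
    _ = _ := by rw [integral_const_mul]; ring

/-- Even trace moments of a Gaussian matrix series are dominated by those of a scalar Gaussian. -/
lemma integral_trace_series_pow_le [Fintype ι] [Fintype κ] [DecidableEq κ] {s : ℝ≥0}
    (hs : s ≠ 0) {A : ι → Matrix κ κ ℝ} (hA : ∀ i, (A i).IsHermitian) {v : ℝ} (hv0 : 0 ≤ v)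
    (hv : (v • 1 - ∑ i, A i * A i).PosSemidef) (p : ℕ) :
    (∫ z, ((∑ i, z i • A i) ^ (2 * p)).trace ∂(Measure.pi fun _ : ι => gaussianReal 0 s))
        / (2 * p).factorial
      ≤ Fintype.card κ * ((s * v / 2) ^ p / p.factorial) := by
  induction p with
  | zero => simp
  | succ p ih =>
    have h := integral_trace_series_pow_succ_le hs hA hv p
    have hsv : 0 ≤ s * v := mul_nonneg s.2 hv0
    calc _ ≤ ((2 * p + 1) * (s * v) * ∫ z, ((∑ i, z i • A i) ^ (2 * p)).trace
          ∂(Measure.pi fun _ : ι => gaussianReal 0 s)) / (2 * (p + 1)).factorial := by gcongr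
      _ = s * v / (2 * (p + 1)) * ((∫ z, ((∑ i, z i • A i) ^ (2 * p)).trace
          ∂(Measure.pi fun _ : ι => gaussianReal 0 s)) / (2 * p).factorial) := by
        rw [show 2 * (p + 1) = 2 * p + 1 + 1 by ring, Nat.factorial_succ, Nat.factorial_succ]
        push_cast
        field_simp
        ring
      _ ≤ s * v / (2 * (p + 1)) * (Fintype.card κ * ((s * v / 2) ^ p / p.factorial)) := by gcongr
      _ = _ := by
        rw [Nat.factorial_succ, pow_succ]
        push_cast
        field_simp

lemma trace_pow_two_mul_nonneg [Fintype κ] [DecidableEq κ] {H : Matrix κ κ ℝ}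
    (hH : H.IsHermitian) (p : ℕ) : 0 ≤ (H ^ (2 * p)).trace := by
  have h := (posSemidef_conjTranspose_mul_self (H ^ p)).trace_nonneg
  rwa [(hH.pow p).eq, ← pow_add, ← two_mul] at h

/-- The trace of the hyperbolic cosine of a Gaussian matrix series, as a power series. -/
lemma lintegral_tsum_trace_series_le [Fintype ι] [Fintype κ] [DecidableEq κ] {s : ℝ≥0}
    (hs : s ≠ 0) {A : ι → Matrix κ κ ℝ} (hA : ∀ i, (A i).IsHermitian) {v : ℝ} (hv0 : 0 ≤ v)
    (hv : (v • 1 - ∑ i, A i * A i).PosSemidef) (θ : ℝ) :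
    ∫⁻ z, ∑' p : ℕ, ENNReal.ofReal
        (θ ^ (2 * p) * (((∑ i, z i • A i) ^ (2 * p)).trace / (2 * p).factorial))
          ∂(Measure.pi fun _ : ι => gaussianReal 0 s)
      ≤ ENNReal.ofReal (Fintype.card κ * Real.exp (θ ^ 2 * (s * v / 2))) := by
  have hInt : ∀ p : ℕ, Integrable (fun z : ι → ℝ =>
      θ ^ (2 * p) * (((∑ i, z i • A i) ^ (2 * p)).trace / (2 * p).factorial))
      (Measure.pi fun _ : ι => gaussianReal 0 s) := fun p =>
    ((integrable_trace_series_pow s A _).div_const _).const_mul _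
  have hsv : 0 ≤ s * v := mul_nonneg s.2 hv0
  have hexp : HasSum (fun p : ℕ => (Fintype.card κ : ℝ) *
      ((θ ^ 2 * (s * v / 2)) ^ p / p.factorial))
      (Fintype.card κ * Real.exp (θ ^ 2 * (s * v / 2))) := by
    have h := (NormedSpace.expSeries_div_hasSum_exp (θ ^ 2 * (s * v / 2) : ℝ)).mul_left
      (Fintype.card κ : ℝ)
    rwa [← Real.exp_eq_exp_ℝ] at h
  rw [lintegral_tsum fun p => (hInt p).aestronglyMeasurable.aemeasurable.ennreal_ofReal,
    ← hexp.tsum_eq, ENNReal.ofReal_tsum_of_nonneg (fun p => by positivity) hexp.summable]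
  refine ENNReal.tsum_le_tsum fun p => ?_
  rw [← ofReal_integral_eq_lintegral_ofReal (hInt p) (ae_of_all _ fun z =>
    mul_nonneg ((even_two_mul p).pow_nonneg θ) (div_nonneg
      (trace_pow_two_mul_nonneg (isHermitian_series hA z) p) (Nat.cast_nonneg _)))]
  refine ENNReal.ofReal_le_ofReal ?_
  rw [integral_const_mul, integral_div, mul_pow, ← pow_mul, mul_div_assoc, mul_left_comm]
  exact mul_le_mul_of_nonneg_left (integral_trace_series_pow_le hs hA hv0 hv p)
    ((even_two_mul p).pow_nonneg θ)

end MatrixSeriesMoments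

section SpectralNorm

open scoped NNReal Matrix.Norms.L2Operator

variable {m l : Type*} [Fintype m] [Fintype l] [DecidableEq l]

lemma _root_.Matrix.IsHermitian.trace_pow {S : Matrix l l ℝ} (hS : S.IsHermitian) (p : ℕ) :
    (S ^ p).trace = ∑ i, hS.eigenvalues i ^ p := by
  conv_lhs => rw [hS.spectral_theorem, ← map_pow, Unitary.conjStarAlgAut_apply, trace_mul_cycle]
  simp [diagonal_pow, trace]

lemma pow_le_trace_conjTranspose_mul_self_pow {M : Matrix m l ℝ} {t : ℝ}
    (ht : 0 < t) (h : t ≤ specNorm M) (p : ℕ) : t ^ (2 * p) ≤ ((Mᴴ * M) ^ p).trace := by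
  have hS : (Mᴴ * M).IsHermitian := isHermitian_conjTranspose_mul_self M
  have hpos : ∀ i, 0 ≤ hS.eigenvalues i :=
    (posSemidef_conjTranspose_mul_self M).eigenvalues_nonneg
  have hspec : ‖Mᴴ * M‖ = ‖hS.eigenvalues‖ := by
    conv_lhs => rw [hS.spectral_theorem, Unitary.conjStarAlgAut_apply]
    simp only [← Unitary.coe_star, CStarRing.norm_mul_coe_unitary, CStarRing.norm_coe_unitary_mul,
      l2_opNorm_diagonal]
    rfl
  have hle : t ^ 2 ≤ ‖hS.eigenvalues‖ := by
    rw [← hspec, l2_opNorm_conjTranspose_mul_self, ← sq]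
    exact pow_le_pow_left₀ ht.le h 2
  obtain ⟨i, hi⟩ : ∃ i, t ^ 2 ≤ hS.eigenvalues i := by
    by_contra! hlt
    refine hle.not_gt ((pi_norm_lt_iff (by positivity)).2 fun i => ?_)
    rw [Real.norm_of_nonneg (hpos i)]
    exact hlt i
  rw [hS.trace_pow, pow_mul]
  exact (pow_le_pow_left₀ (by positivity) hi p).trans
    (Finset.single_le_sum (fun j _ => pow_nonneg (hpos j) p) (Finset.mem_univ i))

lemma specNorm_conjTranspose [DecidableEq m] (M : Matrix m l ℝ) : specNorm Mᴴ = specNorm M :=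
  l2_opNorm_conjTranspose M

end SpectralNorm

section TailBound

open scoped NNReal

variable {m l : Type*}

/-- The Hermitian dilation of a rectangular real matrix. -/
def dilation (M : Matrix m l ℝ) : Matrix (m ⊕ l) (m ⊕ l) ℝ := fromBlocks 0 M Mᴴ 0

lemma isHermitian_dilation (M : Matrix m l ℝ) : (dilation M).IsHermitian :=
  isHermitian_fromBlocks_iff.2 ⟨isHermitian_zero, rfl, by simp, isHermitian_zero⟩

lemma dilation_sum_smul {ι : Type*} [Fintype ι] (B : ι → Matrix m l ℝ) (z : ι → ℝ) :
    dilation (∑ i, z i • B i) = ∑ i, z i • dilation (B i) := by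
  ext (a | a) (b | b) <;> simp [dilation, Matrix.sum_apply]

variable [Fintype m] [Fintype l]

lemma dilation_mul_self (M : Matrix m l ℝ) :
    dilation M * dilation M = fromBlocks (M * Mᴴ) 0 0 (Mᴴ * M) := by
  simp [dilation, fromBlocks_multiply]

lemma posSemidef_fromBlocks_zero {S : Matrix m m ℝ} {T : Matrix l l ℝ} (hS : S.PosSemidef)
    (hT : T.PosSemidef) : (fromBlocks S 0 0 T).PosSemidef := by
  refine PosSemidef.of_dotProduct_mulVec_nonneg
    (isHermitian_fromBlocks_iff.2 ⟨hS.1, by simp, by simp, hT.1⟩) fun x => ?_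
  have h1 := hS.dotProduct_mulVec_nonneg (x ∘ Sum.inl)
  have h2 := hT.dotProduct_mulVec_nonneg (x ∘ Sum.inr)
  simpa [fromBlocks_mulVec, dotProduct, Fintype.sum_sum_type] using add_nonneg h1 h2

variable [DecidableEq m] [DecidableEq l]

lemma two_mul_pow_le_trace_dilation_pow {M : Matrix m l ℝ} {t : ℝ} (ht : 0 < t)
    (h : t ≤ specNorm M) (p : ℕ) : 2 * t ^ (2 * p) ≤ (dilation M ^ (2 * p)).trace := by
  have h1 := pow_le_trace_conjTranspose_mul_self_pow ht h p
  have h2 := pow_le_trace_conjTranspose_mul_self_pow ht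
    (h.trans_eq (specNorm_conjTranspose M).symm) p
  rw [conjTranspose_conjTranspose] at h2
  rw [pow_mul (dilation M), sq, dilation_mul_self, fromBlocks_diagonal_pow]
  simp only [trace, diag_apply, Fintype.sum_sum_type, fromBlocks_apply₁₁,
    fromBlocks_apply₂₂] at h1 h2 ⊢
  linarith

/-- Tail bound for the spectral norm of a Gaussian series with rectangular coefficients. -/
theorem measure_specNorm_gaussian_series_ge_le {ι : Type*} [Fintype ι] {s : ℝ≥0} (hs : s ≠ 0)
    (B : ι → Matrix m l ℝ) {v : ℝ} (hv0 : 0 < v)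
    (hrow : (v • 1 - ∑ i, B i * (B i)ᴴ).PosSemidef)
    (hcol : (v • 1 - ∑ i, (B i)ᴴ * B i).PosSemidef) {t : ℝ} (ht : 0 < t) :
    (Measure.pi fun _ : ι => gaussianReal 0 s) {z | t ≤ specNorm (∑ i, z i • B i)}
      ≤ ENNReal.ofReal
          ((Fintype.card m + Fintype.card l) * Real.exp (-t ^ 2 / (2 * (s * v)))) := by
  have hs0 : (0 : ℝ) < s := by exact_mod_cast pos_iff_ne_zero.2 hs
  have hsv : 0 < s * v := mul_pos hs0 hv0
  have hv : (v • 1 - ∑ i, dilation (B i) * dilation (B i)).PosSemidef := by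
    have : v • 1 - ∑ i, dilation (B i) * dilation (B i)
        = fromBlocks (v • 1 - ∑ i, B i * (B i)ᴴ) 0 0 (v • 1 - ∑ i, (B i)ᴴ * B i) := by
      simp only [dilation_mul_self]
      ext (a | a) (b | b) <;> simp [Matrix.sum_apply, one_apply]
    rw [this]
    exact posSemidef_fromBlocks_zero hrow hcol
  obtain ⟨θ, hθ⟩ : ∃ θ, θ = t / (s * v) := ⟨_, rfl⟩
  have hθ0 : 0 < θ := hθ ▸ div_pos ht hsv
  have hsub : ∀ z : ι → ℝ, t ≤ specNorm (∑ i, z i • B i) →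
      ENNReal.ofReal (Real.exp (θ * t)) ≤ ∑' p : ℕ, ENNReal.ofReal (θ ^ (2 * p) *
        (((∑ i, z i • dilation (B i)) ^ (2 * p)).trace / (2 * p).factorial)) := fun z hz => by
    have hc := (Real.hasSum_cosh (θ * t)).mul_left 2
    calc ENNReal.ofReal (Real.exp (θ * t)) ≤ ENNReal.ofReal (2 * Real.cosh (θ * t)) := by
          refine ENNReal.ofReal_le_ofReal ?_
          rw [Real.cosh_eq]
          linarith [Real.exp_pos (-(θ * t))]
      _ = ∑' p : ℕ, ENNReal.ofReal (2 * ((θ * t) ^ (2 * p) / (2 * p).factorial)) := by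
          rw [← hc.tsum_eq, ENNReal.ofReal_tsum_of_nonneg (fun p => by positivity) hc.summable]
      _ ≤ _ := by
          refine ENNReal.tsum_le_tsum fun p => ENNReal.ofReal_le_ofReal ?_
          have h := two_mul_pow_le_trace_dilation_pow ht hz p
          rw [dilation_sum_smul] at h
          calc 2 * ((θ * t) ^ (2 * p) / (2 * p).factorial)
              = θ ^ (2 * p) * (2 * t ^ (2 * p) / (2 * p).factorial) := by ring
            _ ≤ _ := by gcongr
  have hmeas : AEMeasurable (fun z : ι → ℝ => ∑' p : ℕ, ENNReal.ofReal (θ ^ (2 * p) *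
      (((∑ i, z i • dilation (B i)) ^ (2 * p)).trace / (2 * p).factorial)))
      (Measure.pi fun _ : ι => gaussianReal 0 s) :=
    AEMeasurable.tsum fun p => (((integrable_trace_series_pow s _ _).div_const _).const_mul
      _).aestronglyMeasurable.aemeasurable.ennreal_ofReal
  refine (measure_mono hsub).trans <| (meas_ge_le_lintegral_div hmeas
    (by simp [Real.exp_pos]) ENNReal.ofReal_ne_top).trans <| (ENNReal.div_le_div_right
      (lintegral_tsum_trace_series_le hs (fun i => isHermitian_dilation (B i)) hv0.le hv θ)
      _).trans_eq ?_
  rw [← ENNReal.ofReal_div_of_pos (Real.exp_pos _), mul_div_assoc, ← Real.exp_sub,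
    Fintype.card_sum, Nat.cast_add]
  congr 3
  rw [hθ]
  field_simp
  ring

end TailBound

section Matricization

open scoped NNReal

lemma embed_self (k : Fin n) (ik : Fin (d k)) (rest : RestIdx d k) : embed k ik rest k = ik := by
  simp [embed]

lemma embed_of_ne (k : Fin n) (ik : Fin (d k)) (rest : RestIdx d k) (j : {j : Fin n // j ≠ k}) :
    embed k ik rest j.1 = rest j := by
  simp [embed, j.2]

lemma embed_split (k : Fin n) (i : Index d) : embed k (i k) (fun j => i j.1) = i := by
  funext j
  by_cases h : j = k
  · subst h
    exact embed_self j _ _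
  · exact embed_of_ne k _ _ ⟨j, h⟩

/-- Splitting a tensor index into its mode-`k` coordinate and the remaining coordinates. -/
def splitEquiv (d : Fin n → ℕ) (k : Fin n) : Index d ≃ Fin (d k) × RestIdx d k where
  toFun i := (i k, fun j => i j.1)
  invFun q := embed k q.1 q.2
  left_inv i := embed_split k i
  right_inv q := Prod.ext (embed_self k q.1 q.2) (funext (embed_of_ne k q.1 q.2))

lemma sum_index {M : Type*} [AddCommMonoid M] (k : Fin n) (f : Fin (d k) → RestIdx d k → M) :
    ∑ i : Index d, f (i k) (fun j => i j.1) = ∑ ik, ∑ rest, f ik rest := by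
  rw [← Fintype.sum_prod_type', ← (splitEquiv d k).sum_comp]
  rfl

/-- The matricization of the tensor supported at the index `i`, with value `a i` there. -/
def unitMatricization (k : Fin n) (a : Tensor d) (i : Index d) :
    Matrix (Fin (d k)) (RestIdx d k) ℝ :=
  Matrix.single (i k) (fun j => i j.1) (a i)

lemma matricize_eq_sum (k : Fin n) (a z : Tensor d) :
    matricize k (fun i => a i * z i) = ∑ i, z i • unitMatricization k a i := by
  have h := sum_index k fun ik rest => z (embed k ik rest) •
    Matrix.single ik rest (a (embed k ik rest))
  simp only [embed_split] at h
  simp only [unitMatricization]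
  rw [h]
  ext ik rest
  simp [matricize, Matrix.sum_apply, Matrix.single_apply, mul_comm, ite_and]

lemma sum_unitMatricization_mul_conjTranspose (k : Fin n) (a : Tensor d) :
    ∑ i, unitMatricization k a i * (unitMatricization k a i)ᴴ
      = diagonal fun ik => ∑ rest, a (embed k ik rest) ^ 2 := by
  have h := sum_index k fun ik rest =>
    Matrix.single ik ik (a (embed k ik rest) ^ 2)
  simp only [embed_split] at h
  simp only [unitMatricization, conjTranspose_single, single_mul_single_same, star_trivial, ← sq]
  rw [h]
  ext x y
  simp [Matrix.sum_apply, Matrix.single_apply, diagonal_apply, ite_and]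

lemma sum_conjTranspose_mul_unitMatricization (k : Fin n) (a : Tensor d) :
    ∑ i, (unitMatricization k a i)ᴴ * unitMatricization k a i
      = diagonal fun rest => ∑ ik, a (embed k ik rest) ^ 2 := by
  have h := sum_index k fun ik rest =>
    Matrix.single rest rest (a (embed k ik rest) ^ 2)
  simp only [embed_split] at h
  simp only [unitMatricization, conjTranspose_single, single_mul_single_same, star_trivial, ← sq]
  rw [h]
  ext x y
  simp [Matrix.sum_apply, Matrix.single_apply, diagonal_apply, ite_and]

lemma posSemidef_smul_one_sub_diagonal {κ : Type*} [DecidableEq κ] {v : ℝ}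
    {c : κ → ℝ} (hc : ∀ x, c x ≤ v) : (v • 1 - diagonal c).PosSemidef := by
  rw [smul_one_eq_diagonal, diagonal_sub]
  exact PosSemidef.diagonal fun x => sub_nonneg.2 (hc x)

lemma Dk_eq_card (d : Fin n → ℕ) (k : Fin n) :
    Dk d k = Fintype.card (Fin (d k)) + Fintype.card (RestIdx d k) := by
  have h : ∏ j ∈ Finset.univ.erase k, (d j : ℝ) = ∏ j : {j : Fin n // j ≠ k}, (d j.1 : ℝ) :=
    Finset.prod_subtype _ (by simp) _
  simp [Dk, h, Fintype.card_pi]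

lemma two_le_Dk {k : Fin n} (i : Index d) : 2 ≤ Dk d k := by
  have h₁ : 0 < Fintype.card (Fin (d k)) := Fintype.card_pos_iff.2 ⟨i k⟩
  have h₂ : 0 < Fintype.card (RestIdx d k) := Fintype.card_pos_iff.2 ⟨fun j => i j.1⟩
  rw [Dk_eq_card]
  exact_mod_cast Nat.add_le_add h₁ h₂

lemma measure_specNorm_matricize_ge_le (a : Tensor d) {σ : ℝ} (hσ : 0 < σ) (k : Fin n) {v : ℝ}
    (hv : 0 < v) (hrow : ∀ ik, ∑ rest, a (embed k ik rest) ^ 2 ≤ v)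
    (hcol : ∀ rest, ∑ ik, a (embed k ik rest) ^ 2 ≤ v) {t : ℝ} (ht : 0 < t) :
    gaussianTensor d σ {z | t ≤ specNorm (matricize k fun i => a i * z i)}
      ≤ ENNReal.ofReal (Dk d k * Real.exp (-t ^ 2 / (2 * σ ^ 2 * v))) := by
  have hs : (σ ^ 2).toNNReal ≠ 0 := (Real.toNNReal_pos.2 (by positivity)).ne'
  have h := measure_specNorm_gaussian_series_ge_le hs (unitMatricization k a) hv
    (by
      rw [sum_unitMatricization_mul_conjTranspose]
      exact posSemidef_smul_one_sub_diagonal hrow)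
    (by
      rw [sum_conjTranspose_mul_unitMatricization]
      exact posSemidef_smul_one_sub_diagonal hcol) ht
  rw [Real.coe_toNNReal _ (sq_nonneg σ), ← Dk_eq_card, ← mul_assoc 2] at h
  simpa only [matricize_eq_sum, gaussianTensor] using h

lemma one_sub_le_of_measure_ge_le {α : Type*} [MeasurableSpace α] (P : Measure α)
    [IsProbabilityMeasure P] {f : α → ℝ} {t ε : ℝ} (hε : 0 ≤ ε)
    (h : P {z | t ≤ f z} ≤ ENNReal.ofReal ε) : ENNReal.ofReal (1 - ε) ≤ P {z | f z ≤ t} := by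
  rw [ENNReal.ofReal_sub _ hε, ENNReal.ofReal_one, tsub_le_iff_right, ← measure_univ (μ := P)]
  calc P Set.univ ≤ P ({z | f z ≤ t} ∪ {z | t ≤ f z}) := measure_mono fun z _ => le_total (f z) t
    _ ≤ P {z | f z ≤ t} + P {z | t ≤ f z} := measure_union_le _ _
    _ ≤ P {z | f z ≤ t} + ENNReal.ofReal ε := by gcongr

lemma sq_epow_mul_indic {W : Tensor d} (hW : ∀ i, 0 < W i) (Ω : Finset (Index d)) (i : Index d) :
    (epow W (-(1/2)) i * indic Ω i) ^ 2 = if i ∈ Ω then 1 / W i else 0 := by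
  by_cases h : i ∈ Ω
  · simp only [epow, indic, h, if_true, mul_one]
    rw [← Real.rpow_natCast, ← Real.rpow_mul (hW i).le]
    norm_num [Real.rpow_neg_one]
  · simp [indic, h]

end Matricization

theorem noise_matricization_spectral_bound
    {n : ℕ} {d : Fin n → ℕ} (W : Tensor d) (hWpos : ∀ i, 0 < W i)
    (Ω : Finset (Index d)) (σ : ℝ) (hσ : 0 < σ) (k : Fin n)
    (μk : ℝ) (hμ0 : 0 ≤ μk)
    (hμ : μk ^ 2 =
      max (⨆ ik : Fin (d k), ∑ rest : RestIdx d k,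
            (if embed k ik rest ∈ Ω then 1 / W (embed k ik rest) else 0))
          (⨆ rest : RestIdx d k, ∑ ik : Fin (d k),
            (if embed k ik rest ∈ Ω then 1 / W (embed k ik rest) else 0))) :
    (∀ t : ℝ, 0 < t →
      gaussianTensor d σ {z : Tensor d |
          t ≤ specNorm (matricize k (hadamard (epow W (-(1/2))) (fun i => indic Ω i * z i)))}
        ≤ ENNReal.ofReal (Dk d k * Real.exp (-(t ^ 2) / (2 * σ ^ 2 * μk ^ 2)))) ∧
    ENNReal.ofReal (1 - 1 / Dk d k) ≤
      gaussianTensor d σ {z : Tensor d |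
        specNorm (matricize k (hadamard (epow W (-(1/2))) (fun i => indic Ω i * z i)))
          ≤ 2 * σ * μk * Real.sqrt (Real.log (Dk d k))} := by
  set a : Tensor d := fun i => epow W (-(1/2)) i * indic Ω i
  have hX : ∀ z : Tensor d,
      hadamard (epow W (-(1/2))) (fun i => indic Ω i * z i) = fun i => a i * z i :=
    fun z => funext fun i => (mul_assoc _ _ _).symm
  have hsq : ∀ i, a i ^ 2 = if i ∈ Ω then 1 / W i else 0 := sq_epow_mul_indic hWpos Ω
  simp only [← hsq] at hμ
  have hrow : ∀ ik, ∑ rest, a (embed k ik rest) ^ 2 ≤ μk ^ 2 := fun ik =>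
    hμ ▸ (le_ciSup (f := fun ik => ∑ rest, a (embed k ik rest) ^ 2)
      (Set.finite_range _).bddAbove ik).trans (le_max_left _ _)
  have hcol : ∀ rest, ∑ ik, a (embed k ik rest) ^ 2 ≤ μk ^ 2 := fun rest =>
    hμ ▸ (le_ciSup (f := fun rest => ∑ ik, a (embed k ik rest) ^ 2)
      (Set.finite_range _).bddAbove rest).trans (le_max_right _ _)
  have hprob : IsProbabilityMeasure (gaussianTensor d σ) := by
    unfold gaussianTensor
    infer_instance
  simp only [hX]
  rcases hμ0.eq_or_lt with rfl | hpos
  · have ha0 : ∀ i, a i = 0 := fun i => by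
      have h := (Finset.single_le_sum (f := fun rest => a (embed k (i k) rest) ^ 2)
        (fun _ _ => sq_nonneg _) (Finset.mem_univ fun j : {j : Fin n // j ≠ k} => i j.1)).trans (hrow (i k))
      rw [embed_split] at h
      exact pow_eq_zero_iff two_ne_zero |>.1 (le_antisymm (by simpa using h) (sq_nonneg _))
    have hnorm : ∀ z : Tensor d, specNorm (matricize k fun i => a i * z i) = 0 := fun z => by
      have h0 : matricize k (fun i => a i * z i) = 0 := by
        ext ik rest
        simp [matricize, ha0]
      simp [h0, specNorm]
    have hD : 0 ≤ Dk d k := by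
      rw [Dk_eq_card]
      positivity
    refine ⟨fun t ht => ?_, ?_⟩
    · simp [hnorm, ht.not_ge]
    · simp [hnorm, hD]
  have htail := fun t (ht : 0 < t) =>
    measure_specNorm_matricize_ge_le a hσ k (pow_pos hpos 2) hrow hcol ht
  refine ⟨htail, ?_⟩
  have hne : Nonempty (Index d) := by
    by_contra hempty
    have := not_nonempty_iff.1 hempty
    have hzero : ∀ ik rest, a (embed k ik rest) ^ 2 = 0 := fun ik rest =>
      isEmptyElim (embed k ik rest)
    simp only [hzero, Finset.sum_const_zero, Real.iSup_const_zero, max_self] at hμ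
    exact (pow_pos hpos 2).ne' hμ
  have hD : 2 ≤ Dk d k := two_le_Dk hne.some
  have hlog : 0 < Real.log (Dk d k) := Real.log_pos (by linarith)
  refine one_sub_le_of_measure_ge_le _ (by positivity) ((htail _ (by positivity)).trans_eq ?_)
  congr 1
  have hexp : -(2 * σ * μk * Real.sqrt (Real.log (Dk d k))) ^ 2 / (2 * σ ^ 2 * μk ^ 2)
      = -(Real.log (Dk d k) + Real.log (Dk d k)) := by
    rw [mul_pow, Real.sq_sqrt hlog.le]
    field_simp
    ring
  rw [hexp, Real.exp_neg, Real.exp_add, Real.exp_log (by linarith)]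
  field_simp

end WTC
end
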